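/- Let s = 1/2. Let δ_n be a positive sequence with δ_n → 0, set Λ_n = 1/δ_n, let T_n = L_n(Λ_n+1)δ_n with L_n a positive integer, and let u_n be a minimizer of ℱ^{T_n}_{1/2} over 𝒜^{T_n,Λ_n,δ_n}. Then lim_{n→∞} ℱ^{T_n}_{1/2}(u_n) / log(1/δ_n) = 1. -/

import Mathlib

open MeasureTheory Filter Set Topology

noncomputable section

/-- A function `u : ℝ → ℝ` is piecewise affine: it is affine in a neighborhood of every
point outside a closed discrete set (the corner set). -/
def PiecewiseAffine (u : ℝ → ℝ) : Prop :=
  ∃ S : Set ℝ, IsClosed S ∧ (∀ x ∈ S, ∃ ε > 0, S ∩ Set.Ioo (x - ε) (x + ε) ⊆ {x}) ∧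
    ∀ x ∉ S, ∃ ε > 0, ∃ m q : ℝ, ∀ y : ℝ, |y - x| < ε → u y = m * y + q

/-- The admissible class `𝒜^{T,Λ,δ}`: continuous, `T`-periodic, piecewise affine functions
with slope in `{1, -Λ}` a.e., such that the region where the slope is `-Λ` is a union of
intervals of length `δ` whose pairwise intersections contain at most one point. -/
structure Admissible (T Λ δ : ℝ) (u : ℝ → ℝ) : Prop where
  cont : Continuous u
  per : Function.Periodic u T
  pwAffine : PiecewiseAffine u
  slopes : ∀ᵐ x : ℝ ∂volume, HasDerivAt u 1 x ∨ HasDerivAt u (-Λ) x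
  negRegion : ∃ a : ℕ → ℝ,
    (∀ k : ℕ, Set.Ioo (a k) (a k + δ) ⊆ {x : ℝ | HasDerivAt u (-Λ) x}) ∧
    ({x : ℝ | HasDerivAt u (-Λ) x} ⊆ ⋃ k : ℕ, Set.Icc (a k) (a k + δ)) ∧
    (Pairwise fun i j : ℕ =>
      (Set.Icc (a i) (a i + δ) ∩ Set.Icc (a j) (a j + δ)).Subsingleton)

/-- The `s`-fractional Gagliardo seminorm energy density
`ℱ^T_s(u) = (1/(2T)) ∫_0^T ∫_ℝ |u(x)-u(y)|²/|x-y|^{1+2s} dy dx`. -/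
def Fs (s T : ℝ) (u : ℝ → ℝ) : ℝ :=
  (1 / (2 * T)) * ∫ x in Set.Ioo (0 : ℝ) T, ∫ y : ℝ, (u x - u y) ^ 2 / |x - y| ^ (1 + 2 * s)

/-- The `s`-fractional Laplacian
`(-Δ)^s u (x) = 2 lim_{r→0⁺} ∫_{ℝ∖(x-r,x+r)} (u(x)-u(y))/|x-y|^{1+2s} dy`. -/
def fracLap (s : ℝ) (u : ℝ → ℝ) (x : ℝ) : ℝ :=
  limUnder (𝓝[>] (0 : ℝ)) fun r : ℝ =>
    2 * ∫ y in {y : ℝ | r ≤ |x - y|}, (u x - u y) / |x - y| ^ (1 + 2 * s)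

/-- The function `ū`: the `(Λ+1)δ`-periodic function equal to `-Λx` on `(-δ,0)` and to
`x` on `[0,Λδ]`. -/
def ubar (Λ δ : ℝ) (x : ℝ) : ℝ :=
  let y := ((Λ + 1) * δ) * Int.fract ((x + δ) / ((Λ + 1) * δ)) - δ
  if y < 0 then -Λ * y else y

/-- The extremal energy for `s = 0`: `ℱ^T_0(u) = (1/(2T)) ∫_0^T |u(x)|² dx`. -/
def F0 (T : ℝ) (u : ℝ → ℝ) : ℝ :=
  (1 / (2 * T)) * ∫ x in Set.Ioo (0 : ℝ) T, (u x) ^ 2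

/-- The extremal energy for `s = 1`: `ℱ^T_1(u) = (1/(2T)) ∫_0^T |u'(x)|² dx`. -/
def F1 (T : ℝ) (u : ℝ → ℝ) : ℝ :=
  (1 / (2 * T)) * ∫ x in Set.Ioo (0 : ℝ) T, (deriv u x) ^ 2

/-- The squared `L²(0,T)` norm of the increment of `u` by `h`. -/
def sqIncrement (T : ℝ) (u : ℝ → ℝ) (h : ℝ) : ℝ :=
  ∫ x in (0 : ℝ)..T, (u (x + h) - u x) ^ 2

theorem sqIncrement_nonneg {T : ℝ} (hT : 0 ≤ T) (u : ℝ → ℝ) (h : ℝ) :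
    0 ≤ sqIncrement T u h :=
  intervalIntegral.integral_nonneg hT fun _ _ => sq_nonneg _

theorem sqIncrement_neg {T : ℝ} {u : ℝ → ℝ} (hper : Function.Periodic u T) (h : ℝ) :
    sqIncrement T u (-h) = sqIncrement T u h := by
  have hp : Function.Periodic (fun x => (u (x + h) - u x) ^ 2) T := fun x => by
    simp only [add_right_comm x T h, hper x, hper (x + h)]
  have h1 := hp.intervalIntegral_add_eq (-h) 0
  have h2 := intervalIntegral.integral_comp_add_right
    (fun x => (u (x + h) - u x) ^ 2) (a := 0) (b := T) (-h)
  simp only [zero_add, neg_add_cancel_right] at h1 h2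
  rw [sqIncrement, sqIncrement, ← h1, add_comm (-h) T, ← h2]
  refine intervalIntegral.integral_congr fun x _ => ?_
  ring

theorem sqIncrement_abs {T : ℝ} {u : ℝ → ℝ} (hper : Function.Periodic u T) (h : ℝ) :
    sqIncrement T u |h| = sqIncrement T u h := by
  rcases abs_choice h with h' | h' <;> rw [h']
  exact sqIncrement_neg hper h

theorem integrable_prod_sq_div_sq {T K C : ℝ} {u : ℝ → ℝ} (hu : Continuous u)
    (hK : ∀ x y, |u x - u y| ≤ K * |x - y|) (hC : ∀ x, |u x| ≤ C) :
    Integrable (fun p : ℝ × ℝ => (u (p.1 + p.2) - u p.1) ^ 2 / p.2 ^ 2)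
      ((volume.restrict (Ioo 0 T)).prod volume) := by
  have hg : Integrable (fun p : ℝ × ℝ => (K ^ 2 + (2 * C) ^ 2) * (1 + p.2 ^ 2)⁻¹)
      ((volume.restrict (Ioo 0 T)).prod volume) :=
    (integrable_inv_one_add_sq.comp_snd _).const_mul _
  refine hg.mono' ?_ (Eventually.of_forall fun p => ?_)
  · have := hu.measurable
    exact (by fun_prop : Measurable fun p : ℝ × ℝ =>
      (u (p.1 + p.2) - u p.1) ^ 2 / p.2 ^ 2).aestronglyMeasurable
  · obtain ⟨x, h⟩ := p
    rw [Real.norm_of_nonneg (by positivity)]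
    rcases eq_or_ne h 0 with rfl | hh
    · simp; positivity
    · have h1 : (u (x + h) - u x) ^ 2 ≤ K ^ 2 * h ^ 2 := by
        have := hK (x + h) x
        rw [add_sub_cancel_left] at this
        calc _ = |u (x + h) - u x| ^ 2 := (sq_abs _).symm
          _ ≤ (K * |h|) ^ 2 := by gcongr
          _ = _ := by rw [mul_pow, sq_abs]
      have h2 : (u (x + h) - u x) ^ 2 ≤ (2 * C) ^ 2 := by
        refine sq_le_sq' ?_ ?_ <;>
        linarith [abs_le.1 (hC x), abs_le.1 (hC (x + h))]
      have : 0 < h ^ 2 := by positivity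
      dsimp only
      rw [← div_eq_mul_inv, div_le_div_iff₀ this (by positivity)]
      nlinarith

theorem integrable_sqIncrement_div_sq {T K C : ℝ} (hT : 0 ≤ T) {u : ℝ → ℝ} (hu : Continuous u)
    (hK : ∀ x y, |u x - u y| ≤ K * |x - y|) (hC : ∀ x, |u x| ≤ C) :
    Integrable fun h : ℝ => sqIncrement T u h / h ^ 2 := by
  refine (integrable_prod_sq_div_sq (T := T) hu hK hC).integral_prod_right.congr
    (Eventually.of_forall fun h => ?_)
  dsimp only
  rw [integral_div, sqIncrement, intervalIntegral.integral_of_le hT, integral_Ioc_eq_integral_Ioo]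

theorem Fs_half_eq {T K C : ℝ} (hT : 0 ≤ T) {u : ℝ → ℝ} (hu : Continuous u)
    (hper : Function.Periodic u T)
    (hK : ∀ x y, |u x - u y| ≤ K * |x - y|) (hC : ∀ x, |u x| ≤ C) :
    Fs (1 / 2) T u = T⁻¹ * ∫ h in Ioi (0 : ℝ), sqIncrement T u h / h ^ 2 := by
  have h1 : ∀ x : ℝ, ∫ y : ℝ, (u x - u y) ^ 2 / |x - y| ^ (1 + 2 * (1 / 2 : ℝ)) =
      ∫ h : ℝ, (u (x + h) - u x) ^ 2 / h ^ 2 := fun x => by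
    rw [← integral_add_left_eq_self _ x]
    refine integral_congr_ae (Eventually.of_forall fun h => ?_)
    have : (1 + 2 * (1 / 2 : ℝ)) = (2 : ℕ) := by norm_num
    dsimp only
    rw [this, Real.rpow_natCast, sq_abs, sub_add_cancel_left, neg_sq, ← neg_sub, neg_sq]
  have h2 : ∀ h : ℝ, ∫ x in Ioo 0 T, (u (x + h) - u x) ^ 2 / h ^ 2 =
      sqIncrement T u |h| / |h| ^ 2 := fun h => by
    rw [integral_div, sqIncrement_abs hper, sq_abs, sqIncrement,
      intervalIntegral.integral_of_le hT, integral_Ioc_eq_integral_Ioo]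
  rw [Fs]
  simp_rw [h1]
  rw [integral_integral_swap (integrable_prod_sq_div_sq hu hK hC)]
  simp_rw [h2]
  rw [integral_comp_abs (f := fun h => sqIncrement T u h / h ^ 2)]
  field_simp

theorem PiecewiseAffine.exists_countable {u : ℝ → ℝ} (hu : PiecewiseAffine u) :
    ∃ S : Set ℝ, S.Countable ∧
      ∀ x ∉ S, ∃ ε > 0, ∃ m q : ℝ, ∀ y : ℝ, |y - x| < ε → u y = m * y + q := by
  obtain ⟨S, -, hS, hu⟩ := hu
  refine ⟨S, ?_, hu⟩
  have : DiscreteTopology S := by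
    rw [discreteTopology_subtype_iff']
    intro x hx
    obtain ⟨ε, hε, h⟩ := hS x hx
    refine ⟨Ioo (x - ε) (x + ε), isOpen_Ioo, subset_antisymm (by rwa [inter_comm]) ?_⟩
    rintro _ rfl
    exact ⟨⟨by linarith, by linarith⟩, hx⟩
  have := TopologicalSpace.separableSpace_iff_countable.1
    (inferInstance : TopologicalSpace.SeparableSpace S)
  exact S.to_countable

theorem PiecewiseAffine.hasDerivAt_of_ae {u : ℝ → ℝ} {p q : ℝ} (hu : PiecewiseAffine u)
    (h : ∀ᵐ x : ℝ, HasDerivAt u p x ∨ HasDerivAt u q x) :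
    ∃ S : Set ℝ, S.Countable ∧ ∀ x ∉ S, HasDerivAt u p x ∨ HasDerivAt u q x := by
  obtain ⟨S, hS, hu⟩ := hu.exists_countable
  refine ⟨S, hS, fun x hx => ?_⟩
  obtain ⟨ε, hε, m, b, hm⟩ := hu x hx
  have hd : ∀ y ∈ Metric.ball x ε, HasDerivAt u m y := fun y hy => by
    have : HasDerivAt (fun y => m * y + b) m y := by
      simpa using ((hasDerivAt_id y).const_mul m).add_const b
    refine this.congr_of_eventuallyEq ?_
    filter_upwards [Metric.isOpen_ball.mem_nhds hy] with z hz using hm z hz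
  have hpos : (volume : Measure ℝ).restrict (Metric.ball x ε) ≠ 0 := by
    simpa using hε
  have : (ae ((volume : Measure ℝ).restrict (Metric.ball x ε))).NeBot := ae_neBot.2 hpos
  obtain ⟨y, hy, hyb⟩ :=
    ((ae_restrict_of_ae (s := Metric.ball x ε) h).and
      (ae_restrict_mem Metric.isOpen_ball.measurableSet)).exists
  have hx := hd x (Metric.mem_ball_self hε)
  rcases hy with hy | hy
  · left; rwa [← (hd y hyb).unique hy]
  · right; rwa [← (hd y hyb).unique hy]

theorem measurableSet_setOf_hasDerivAt (u : ℝ → ℝ) (c : ℝ) :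
    MeasurableSet {x : ℝ | HasDerivAt u c x} := by
  have : {x : ℝ | HasDerivAt u c x} = {x | DifferentiableAt ℝ u x} ∩ deriv u ⁻¹' {c} := by
    ext x
    exact ⟨fun h => ⟨h.differentiableAt, h.deriv⟩, fun ⟨h, h'⟩ => h' ▸ h.hasDerivAt⟩
  rw [this]
  exact (measurableSet_of_differentiableAt ℝ u).inter (measurable_deriv u (measurableSet_singleton c))

namespace Admissible

variable {T Λ δ : ℝ} {u : ℝ → ℝ}

theorem sub_eq (hu : Admissible T Λ δ u) {x y : ℝ} (hxy : x ≤ y) :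
    u y - u x = (y - x) - (1 + Λ) * volume.real ({z | HasDerivAt u (-Λ) z} ∩ Ioc x y) := by
  obtain ⟨S, hS, hd⟩ := hu.pwAffine.hasDerivAt_of_ae hu.slopes
  set N : Set ℝ := {z | HasDerivAt u (-Λ) z} with hN
  have hNm : MeasurableSet N := measurableSet_setOf_hasDerivAt u (-Λ)
  have hi : IntervalIntegrable (N.indicator fun _ => (1 : ℝ)) volume x y := by
    exact intervalIntegrable_iff.2
      ((intervalIntegrable_iff.1 intervalIntegrable_const).indicator hNm)
  have key := integral_eq_of_hasDerivAt_off_countable_of_le u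
    (fun z => 1 - (1 + Λ) * N.indicator (fun _ => (1 : ℝ)) z) hxy hS hu.cont.continuousOn
    (fun z hz => by
      by_cases hzN : z ∈ N
      · have hz' : HasDerivAt u (-Λ) z := hzN
        simpa [indicator_of_mem hzN] using hz'
      · simpa [hzN] using (hd z hz.2).resolve_right hzN)
    (intervalIntegrable_const.sub (hi.const_mul _))
  rw [← key, intervalIntegral.integral_sub intervalIntegrable_const (hi.const_mul _),
    intervalIntegral.integral_const_mul, intervalIntegral.integral_of_le (f := N.indicator _) hxy,
    setIntegral_indicator hNm, inter_comm]
  simp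

theorem sub_le (hu : Admissible T Λ δ u) (hΛ : 0 ≤ Λ) {x y : ℝ} (hxy : x ≤ y) :
    u y - u x ≤ y - x := by
  rw [hu.sub_eq hxy]
  have : 0 ≤ (1 + Λ) * volume.real ({z | HasDerivAt u (-Λ) z} ∩ Ioc x y) := by positivity
  linarith

theorem neg_mul_le_sub (hu : Admissible T Λ δ u) (hΛ : 0 ≤ Λ) {x y : ℝ} (hxy : x ≤ y) :
    -Λ * (y - x) ≤ u y - u x := by
  rw [hu.sub_eq hxy]
  have : volume.real ({z | HasDerivAt u (-Λ) z} ∩ Ioc x y) ≤ y - x := by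
    have := measureReal_mono (μ := volume)
      (inter_subset_right : {z | HasDerivAt u (-Λ) z} ∩ Ioc x y ⊆ Ioc x y) measure_Ioc_lt_top.ne
    simpa [hxy] using this
  nlinarith

theorem abs_sub_le (hu : Admissible T Λ δ u) (hΛ : 0 ≤ Λ) (x y : ℝ) :
    |u x - u y| ≤ (1 + Λ) * |x - y| := by
  wlog hxy : y ≤ x generalizing x y
  · rw [abs_sub_comm, abs_sub_comm x]
    exact this y x (le_of_not_ge hxy)
  rw [abs_of_nonneg (sub_nonneg.2 hxy), abs_le]
  have h1 := hu.sub_le hΛ hxy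
  have h2 := hu.neg_mul_le_sub hΛ hxy
  have : 0 ≤ Λ * (x - y) := mul_nonneg hΛ (sub_nonneg.2 hxy)
  constructor <;> linarith

theorem exists_abs_le (hu : Admissible T Λ δ u) (hT : T ≠ 0) : ∃ C, ∀ x, |u x| ≤ C := by
  obtain ⟨C, hC⟩ := (hu.per.isBounded_of_continuous hT hu.cont).exists_norm_le
  exact ⟨C, fun x => hC _ (mem_range_self x)⟩

theorem integral_increment (hu : Admissible T Λ δ u) (h : ℝ) :
    ∫ x in (0 : ℝ)..T, (u (x + h) - u x) = 0 := by
  have hc := hu.cont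
  rw [intervalIntegral.integral_sub (Continuous.intervalIntegrable (by fun_prop) _ _)
    (hc.intervalIntegrable _ _), intervalIntegral.integral_comp_add_right, zero_add, add_comm T,
    hu.per.intervalIntegral_add_eq h 0, zero_add, sub_self]

theorem measureReal_negRegion (hu : Admissible T Λ δ u) (hΛ : 0 ≤ Λ) (hT : 0 ≤ T) (x : ℝ) :
    volume.real ({z | HasDerivAt u (-Λ) z} ∩ Ioc x (x + T)) = T / (1 + Λ) := by
  have := hu.sub_eq (le_add_of_nonneg_right hT : x ≤ x + T)
  rw [hu.per, sub_self, add_sub_cancel_left] at this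
  rw [eq_div_iff (by positivity)]
  linarith

/-- The integral of the square of the increment in terms of the excess
`h - (u (x + h) - u x)`. -/
theorem sqIncrement_eq (hu : Admissible T Λ δ u) (h : ℝ) :
    sqIncrement T u h = (∫ x in (0 : ℝ)..T, (h - (u (x + h) - u x)) ^ 2) - T * h ^ 2 := by
  have hc := hu.cont
  have h1 : ∀ x, (u (x + h) - u x) ^ 2 =
      (h - (u (x + h) - u x)) ^ 2 + 2 * h * (u (x + h) - u x) - h ^ 2 := fun x => by ring
  simp_rw [sqIncrement, h1]
  rw [intervalIntegral.integral_sub, intervalIntegral.integral_add,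
    intervalIntegral.integral_const_mul, hu.integral_increment]
  · simp
  all_goals exact Continuous.intervalIntegrable (by fun_prop) _ _

theorem integral_excess (hu : Admissible T Λ δ u) (h : ℝ) :
    ∫ x in (0 : ℝ)..T, (h - (u (x + h) - u x)) = T * h := by
  have hc := hu.cont
  rw [intervalIntegral.integral_sub, hu.integral_increment]
  · simp
  all_goals exact Continuous.intervalIntegrable (by fun_prop) _ _

theorem sqIncrement_le_of_excess_le (hu : Admissible T Λ δ u) (hΛ : 0 ≤ Λ) (hT : 0 ≤ T)
    {h c : ℝ} (hh : 0 ≤ h) (hc : ∀ x, h - (u (x + h) - u x) ≤ c) :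
    sqIncrement T u h ≤ T * h * (c - h) := by
  have hcont := hu.cont
  have : ∫ x in (0 : ℝ)..T, (h - (u (x + h) - u x)) ^ 2 ≤
      ∫ x in (0 : ℝ)..T, c * (h - (u (x + h) - u x)) := by
    refine intervalIntegral.integral_mono_on hT (Continuous.intervalIntegrable (by fun_prop) _ _)
      (Continuous.intervalIntegrable (by fun_prop) _ _) fun x _ => ?_
    have h1 := hu.sub_le hΛ (le_add_of_nonneg_right hh : x ≤ x + h)
    rw [add_sub_cancel_left] at h1
    nlinarith [hc x]
  rw [intervalIntegral.integral_const_mul, hu.integral_excess] at this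
  rw [hu.sqIncrement_eq]
  linarith

end Admissible

namespace Admissible

variable {T Λ δ : ℝ} {u : ℝ → ℝ}

/-- If neither `x` nor `x + h` lies in the region of slope `-Λ`, then `u` drops between them
along a union of full intervals of length `δ`. -/
theorem excess_le_sq (hu : Admissible T Λ δ u) (hδ : 0 < δ) (hΛ : 0 ≤ Λ) (hΛδ : 1 ≤ (1 + Λ) * δ)
    {x h : ℝ} (hh : 0 ≤ h) (hx : ¬ HasDerivAt u (-Λ) x) (hxh : ¬ HasDerivAt u (-Λ) (x + h)) :
    h - (u (x + h) - u x) ≤ (h - (u (x + h) - u x)) ^ 2 := by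
  have hsub := hu.sub_eq (le_add_of_nonneg_right hh : x ≤ x + h)
  set N : Set ℝ := {z | HasDerivAt u (-Λ) z} with hN
  rw [hsub, add_sub_cancel_left, sub_sub_cancel]
  rcases (N ∩ Ioc x (x + h)).eq_empty_or_nonempty with hem | ⟨p, hpN, hp⟩
  · simp [hem]
  obtain ⟨a, ha, hcov, -⟩ := hu.negRegion
  obtain ⟨k, hk⟩ := mem_iUnion.1 (hcov hpN)
  have hph : p < x + h := lt_of_le_of_ne hp.2 fun h' => hxh (h' ▸ hpN)
  have h1 : x ≤ a k := by
    by_contra! hlt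
    exact hx (ha k ⟨hlt, hp.1.trans_le hk.2⟩)
  have h2 : a k + δ ≤ x + h := by
    by_contra! hlt
    exact hxh (ha k ⟨hk.1.trans_lt hph, hlt⟩)
  have hsubset : Ioo (a k) (a k + δ) ⊆ N ∩ Ioc x (x + h) := fun z hz =>
    ⟨ha k hz, h1.trans_lt hz.1, hz.2.le.trans h2⟩
  have hm := measureReal_mono (μ := volume) hsubset
    (measure_ne_top_of_subset inter_subset_right measure_Ioc_lt_top.ne)
  have : δ ≤ volume.real (N ∩ Ioc x (x + h)) := by simpa [hδ.le] using hm
  have : 1 ≤ (1 + Λ) * volume.real (N ∩ Ioc x (x + h)) :=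
    hΛδ.trans (by gcongr)
  exact le_self_pow₀ this two_ne_zero

theorem le_sqIncrement (hu : Admissible T Λ δ u) (hT : 0 ≤ T) (hδ : 0 < δ) (hΛ : 0 ≤ Λ)
    (hΛδ : 1 ≤ (1 + Λ) * δ) {h : ℝ} (hh : 0 ≤ h) :
    T * (h - h ^ 2 - δ / 2) ≤ sqIncrement T u h := by
  have hcont := hu.cont
  set N : Set ℝ := {z | HasDerivAt u (-Λ) z} with hN
  have hNm : MeasurableSet N := measurableSet_setOf_hasDerivAt u (-Λ)
  have hi : ∀ a b, IntervalIntegrable (N.indicator fun _ => (1 : ℝ)) volume a b := fun a b =>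
    intervalIntegrable_iff.2 ((intervalIntegrable_iff.1 intervalIntegrable_const).indicator hNm)
  have hval : ∀ c, ∫ x in c..(c + T), N.indicator (fun _ => (1 : ℝ)) x ≤ T * δ := fun c => by
    rw [intervalIntegral.integral_of_le (by linarith), setIntegral_indicator hNm, inter_comm]
    simp only [integral_const, measureReal_restrict_apply_univ, smul_eq_mul, mul_one]
    rw [hu.measureReal_negRegion hΛ hT, div_le_iff₀ (by positivity)]
    nlinarith
  have hi' : IntervalIntegrable (fun x => N.indicator (fun _ => (1 : ℝ)) (x + h)) volume 0 T := by
    simpa using (hi (0 + h) (T + h)).comp_add_right h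
  have hmono : ∫ x in (0 : ℝ)..T, ((h - (u (x + h) - u x)) -
        (1 / 4 : ℝ) * (N.indicator (fun _ => (1 : ℝ)) x + N.indicator (fun _ => (1 : ℝ)) (x + h))) ≤
      ∫ x in (0 : ℝ)..T, (h - (u (x + h) - u x)) ^ 2 := by
    refine intervalIntegral.integral_mono_on hT
      ((Continuous.intervalIntegrable (by fun_prop) _ _).sub (((hi 0 T).add hi').const_mul _))
      (Continuous.intervalIntegrable (by fun_prop) _ _) fun x _ => ?_
    have h0 : ∀ z, 0 ≤ N.indicator (fun _ => (1 : ℝ)) z := fun z =>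
      indicator_nonneg (fun _ _ => zero_le_one) z
    have hsq := sq_nonneg (h - (u (x + h) - u x) - 1 / 2)
    by_cases hx : x ∈ N
    · have := h0 (x + h)
      rw [indicator_of_mem hx]
      nlinarith
    by_cases hxh : x + h ∈ N
    · have := h0 x
      rw [indicator_of_mem hxh]
      nlinarith
    have := hu.excess_le_sq hδ hΛ hΛδ hh hx hxh
    linarith [h0 x, h0 (x + h)]
  rw [intervalIntegral.integral_sub (Continuous.intervalIntegrable (by fun_prop) _ _)
    (((hi 0 T).add hi').const_mul _), intervalIntegral.integral_const_mul,
    intervalIntegral.integral_add (hi 0 T) hi',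
    intervalIntegral.integral_comp_add_right (fun x => N.indicator (fun _ => (1 : ℝ)) x),
    hu.integral_excess] at hmono
  have h1 := hval 0
  have h2 := hval h
  rw [zero_add] at h1 hmono
  rw [add_comm h T] at h2
  rw [hu.sqIncrement_eq]
  linarith

theorem log_sub_le_Fs_half (hu : Admissible T Λ δ u) (hT : 0 < T) (hδ : 0 < δ) (hδ1 : δ ≤ 1)
    (hΛ : 0 ≤ Λ) (hΛδ : 1 ≤ (1 + Λ) * δ) :
    Real.log (1 / δ) - 3 / 2 ≤ Fs (1 / 2) T u := by
  obtain ⟨C, hC⟩ := hu.exists_abs_le hT.ne'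
  have hK := hu.abs_sub_le hΛ
  have hint := integrable_sqIncrement_div_sq hT.le hu.cont hK hC
  rw [Fs_half_eq hT.le hu.cont hu.per hK hC, le_inv_mul_iff₀ hT]
  have hpos : ∀ h ∈ uIcc δ 1, h ≠ 0 := fun h hh => by
    rw [uIcc_of_le hδ1] at hh
    exact (hδ.trans_le hh.1).ne'
  have hii : IntervalIntegrable (fun h => T * (h⁻¹ - 1 - δ / 2 / h ^ 2)) volume δ 1 := by
    refine ContinuousOn.intervalIntegrable ?_
    have : ∀ h ∈ uIcc δ 1, h ^ 2 ≠ 0 := fun h hh => pow_ne_zero 2 (hpos h hh)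
    fun_prop (disch := assumption)
  have hFTC : ∫ h in δ..1, T * (h⁻¹ - 1 - δ / 2 / h ^ 2) =
      T * (Real.log 1 - 1 + δ / 2 * 1⁻¹) - T * (Real.log δ - δ + δ / 2 * δ⁻¹) := by
    refine intervalIntegral.integral_eq_sub_of_hasDerivAt
      (f := fun h => T * (Real.log h - h + δ / 2 * h⁻¹)) (fun h hh => ?_) hii
    exact ((((Real.hasDerivAt_log (hpos h hh)).sub (hasDerivAt_id h)).add
      ((hasDerivAt_inv (hpos h hh)).const_mul (δ / 2))).const_mul T).congr_deriv (by ring)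
  calc T * (Real.log (1 / δ) - 3 / 2) ≤ ∫ h in δ..1, T * (h⁻¹ - 1 - δ / 2 / h ^ 2) := by
        rw [hFTC, ← mul_sub]
        have : δ / 2 * δ⁻¹ = 1 / 2 := by field_simp
        rw [this]
        simp only [one_div, Real.log_inv, Real.log_one]
        refine mul_le_mul_of_nonneg_left ?_ hT.le
        linarith
    _ ≤ ∫ h in δ..1, sqIncrement T u h / h ^ 2 := by
        refine intervalIntegral.integral_mono_on hδ1 hii hint.intervalIntegrable fun h hh => ?_
        have hh0 : 0 < h := hδ.trans_le hh.1
        rw [le_div_iff₀ (by positivity)]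
        refine Eq.trans_le ?_ (hu.le_sqIncrement hT.le hδ hΛ hΛδ hh0.le)
        field_simp
    _ ≤ _ := by
        rw [intervalIntegral.integral_of_le hδ1]
        exact setIntegral_mono_set hint.integrableOn
          (Eventually.of_forall fun h => div_nonneg (sqIncrement_nonneg hT.le u h) (sq_nonneg h))
          (Ioc_subset_Ioi_self.trans (Ioi_subset_Ioi hδ.le)).eventuallyLE

theorem Fs_half_le_of_mem_Icc (hu : Admissible T Λ δ u) (hT : 0 < T) (hδ : 0 < δ) (hδ1 : δ ≤ 1)
    (hΛ : 0 ≤ Λ) (hosc : ∀ x, u x ∈ Icc (0 : ℝ) 1) :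
    Fs (1 / 2) T u ≤ Real.log (1 / δ) + Λ * δ + 1 := by
  have hC : ∀ x, |u x| ≤ 1 := fun x => abs_le.2 ⟨by linarith [(hosc x).1], (hosc x).2⟩
  have hK := hu.abs_sub_le hΛ
  have hint := integrable_sqIncrement_div_sq hT.le hu.cont hK hC
  rw [Fs_half_eq hT.le hu.cont hu.per hK hC, inv_mul_le_iff₀ hT]
  have hpos : ∀ h ∈ uIcc δ 1, h ≠ 0 := fun h hh => by
    rw [uIcc_of_le hδ1] at hh
    exact (hδ.trans_le hh.1).ne'
  have hmid : ∀ h ≥ 0, sqIncrement T u h ≤ T * h := fun h hh => by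
    have := hu.sqIncrement_le_of_excess_le hΛ hT.le hh (c := 1 + h) fun x => by
      linarith [(hosc x).2, (hosc (x + h)).1]
    linarith
  have hsmall : ∀ h ≥ 0, sqIncrement T u h ≤ T * Λ * h ^ 2 := fun h hh => by
    have := hu.sqIncrement_le_of_excess_le hΛ hT.le hh (c := (1 + Λ) * h) fun x => by
      have := hu.neg_mul_le_sub hΛ (le_add_of_nonneg_right hh : x ≤ x + h)
      rw [add_sub_cancel_left] at this
      linarith
    linarith
  have hlarge : ∀ h, sqIncrement T u h ≤ T := fun h => by
    have hcont := hu.cont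
    have : sqIncrement T u h ≤ ∫ _ in (0 : ℝ)..T, (1 : ℝ) := by
      refine intervalIntegral.integral_mono_on hT.le
        (Continuous.intervalIntegrable (by fun_prop) _ _) intervalIntegrable_const fun x _ => ?_
      have h1 := hosc x
      have h2 := hosc (x + h)
      exact (sq_le_one_iff_abs_le_one _).2
        (abs_le.2 ⟨by linarith [h1.2, h2.1], by linarith [h1.1, h2.2]⟩)
    simpa using this
  have hsplit : ∫ h in Ioi (0 : ℝ), sqIncrement T u h / h ^ 2 =
      (∫ h in (0 : ℝ)..δ, sqIncrement T u h / h ^ 2) +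
      ((∫ h in δ..1, sqIncrement T u h / h ^ 2) + ∫ h in Ioi (1 : ℝ), sqIncrement T u h / h ^ 2) := by
    rw [intervalIntegral.integral_interval_add_Ioi hint.integrableOn hint.integrableOn,
      intervalIntegral.integral_interval_add_Ioi hint.integrableOn hint.integrableOn]
  have i1 : ∫ h in (0 : ℝ)..δ, sqIncrement T u h / h ^ 2 ≤ T * (Λ * δ) := by
    have : ∫ h in (0 : ℝ)..δ, sqIncrement T u h / h ^ 2 ≤ ∫ _ in (0 : ℝ)..δ, T * Λ := by
      refine intervalIntegral.integral_mono_on hδ.le hint.intervalIntegrable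
        intervalIntegrable_const fun h hh => ?_
      exact div_le_of_le_mul₀ (sq_nonneg h) (by positivity) (hsmall h hh.1)
    refine this.trans_eq ?_
    rw [intervalIntegral.integral_const, smul_eq_mul]
    ring
  have i2 : ∫ h in δ..1, sqIncrement T u h / h ^ 2 ≤ T * Real.log (1 / δ) := by
    have : ∫ h in δ..1, sqIncrement T u h / h ^ 2 ≤ ∫ h in δ..1, T * h⁻¹ := by
      refine intervalIntegral.integral_mono_on hδ1 hint.intervalIntegrable
        (ContinuousOn.intervalIntegrable (by fun_prop (disch := assumption))) fun h hh => ?_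
      have hh0 : 0 < h := hδ.trans_le hh.1
      rw [div_le_iff₀ (by positivity)]
      refine (hmid h hh0.le).trans_eq ?_
      field_simp
    refine this.trans_eq ?_
    rw [intervalIntegral.integral_const_mul, integral_inv_of_pos hδ one_pos]
  have i3 : ∫ h in Ioi (1 : ℝ), sqIncrement T u h / h ^ 2 ≤ T := by
    have : ∫ h in Ioi (1 : ℝ), sqIncrement T u h / h ^ 2 ≤
        ∫ h in Ioi (1 : ℝ), T * h ^ (-2 : ℝ) := by
      refine setIntegral_mono_on hint.integrableOn
        ((integrableOn_Ioi_rpow_of_lt (by norm_num) one_pos).const_mul T) measurableSet_Ioi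
        fun h hh => ?_
      have hh0 : 0 < h := one_pos.trans hh
      rw [Real.rpow_neg hh0.le, Real.rpow_two, ← div_eq_mul_inv]
      gcongr
      exact hlarge h
    refine this.trans_eq ?_
    rw [integral_const_mul, integral_Ioi_rpow_of_lt (by norm_num) one_pos]
    norm_num
  rw [hsplit]
  linarith

end Admissible

section ubar

variable {Λ δ : ℝ}

theorem exists_mem_Ico_period (hΛ : 0 < Λ) (hδ : 0 < δ) (x : ℝ) :
    ∃ k : ℤ, x ∈ Ico (k * ((Λ + 1) * δ) - δ) (k * ((Λ + 1) * δ) + Λ * δ) := by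
  have hp : 0 < (Λ + 1) * δ := by positivity
  refine ⟨⌊(x + δ) / ((Λ + 1) * δ)⌋, ?_, ?_⟩
  · have := (le_div_iff₀ hp).1 (Int.floor_le ((x + δ) / ((Λ + 1) * δ)))
    linarith
  · have := (div_lt_iff₀ hp).1 (Int.lt_floor_add_one ((x + δ) / ((Λ + 1) * δ)))
    linarith

theorem ubar_of_mem_Ico (hΛ : 0 < Λ) (hδ : 0 < δ) {x : ℝ} {k : ℤ}
    (hx : x ∈ Ico (k * ((Λ + 1) * δ) - δ) (k * ((Λ + 1) * δ) + Λ * δ)) :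
    ubar Λ δ x = if x - k * ((Λ + 1) * δ) < 0 then -Λ * (x - k * ((Λ + 1) * δ))
      else x - k * ((Λ + 1) * δ) := by
  have hp : 0 < (Λ + 1) * δ := by positivity
  have hfl : ⌊(x + δ) / ((Λ + 1) * δ)⌋ = k := by
    rw [Int.floor_eq_iff, le_div_iff₀ hp, div_lt_iff₀ hp]
    constructor <;> linarith [hx.1, hx.2]
  have hy : (Λ + 1) * δ * Int.fract ((x + δ) / ((Λ + 1) * δ)) - δ =
      x - k * ((Λ + 1) * δ) := by
    rw [← Int.self_sub_floor, hfl, mul_sub, mul_div_cancel₀ _ hp.ne']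
    ring
  simp only [ubar, hy]

theorem ubar_of_mem_Ioo_neg (hΛ : 0 < Λ) (hδ : 0 < δ) {x : ℝ} {k : ℤ}
    (hx : x ∈ Ioo (k * ((Λ + 1) * δ) - δ) (k * ((Λ + 1) * δ))) :
    ubar Λ δ x = -Λ * (x - k * ((Λ + 1) * δ)) := by
  have : 0 < Λ * δ := by positivity
  rw [ubar_of_mem_Ico hΛ hδ ⟨hx.1.le, by linarith [hx.2]⟩, if_pos (by linarith [hx.2])]

theorem ubar_of_mem_Ioo_pos (hΛ : 0 < Λ) (hδ : 0 < δ) {x : ℝ} {k : ℤ}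
    (hx : x ∈ Ioo (k * ((Λ + 1) * δ)) (k * ((Λ + 1) * δ) + Λ * δ)) :
    ubar Λ δ x = x - k * ((Λ + 1) * δ) := by
  rw [ubar_of_mem_Ico hΛ hδ ⟨by linarith [hx.1], hx.2⟩, if_neg (by linarith [hx.1])]

theorem ubar_mem_Icc (hΛ : 0 < Λ) (hδ : 0 < δ) (x : ℝ) : ubar Λ δ x ∈ Icc 0 (Λ * δ) := by
  obtain ⟨k, hk⟩ := exists_mem_Ico_period hΛ hδ x
  rw [ubar_of_mem_Ico hΛ hδ hk]
  split_ifs with h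
  · constructor <;> nlinarith [hk.1]
  · exact ⟨not_lt.1 h, by linarith [hk.2]⟩

theorem hasDerivAt_ubar_neg (hΛ : 0 < Λ) (hδ : 0 < δ) {x : ℝ} {k : ℤ}
    (hx : x ∈ Ioo (k * ((Λ + 1) * δ) - δ) (k * ((Λ + 1) * δ))) :
    HasDerivAt (ubar Λ δ) (-Λ) x := by
  have : HasDerivAt (fun y => -Λ * (y - k * ((Λ + 1) * δ))) (-Λ) x := by
    simpa using ((hasDerivAt_id x).sub_const (k * ((Λ + 1) * δ))).const_mul (-Λ)
  refine this.congr_of_eventuallyEq ?_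
  filter_upwards [isOpen_Ioo.mem_nhds hx] with y hy using ubar_of_mem_Ioo_neg hΛ hδ hy

theorem hasDerivAt_ubar_pos (hΛ : 0 < Λ) (hδ : 0 < δ) {x : ℝ} {k : ℤ}
    (hx : x ∈ Ioo (k * ((Λ + 1) * δ)) (k * ((Λ + 1) * δ) + Λ * δ)) :
    HasDerivAt (ubar Λ δ) 1 x := by
  refine ((hasDerivAt_id x).sub_const (k * ((Λ + 1) * δ))).congr_of_eventuallyEq ?_
  filter_upwards [isOpen_Ioo.mem_nhds hx] with y hy using ubar_of_mem_Ioo_pos hΛ hδ hy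

theorem continuous_ubar (hΛ : 0 < Λ) (hδ : 0 < δ) : Continuous (ubar Λ δ) := by
  have hmax : ubar Λ δ = (fun t : ℝ => max (-Λ * ((Λ + 1) * δ * t - δ)) ((Λ + 1) * δ * t - δ)) ∘
      Int.fract ∘ fun x => (x + δ) / ((Λ + 1) * δ) := by
    ext x
    simp only [ubar, Function.comp_apply]
    split_ifs with h
    · rw [max_eq_left (by nlinarith)]
    · rw [max_eq_right (by nlinarith)]
  rw [hmax, ← Function.comp_assoc]
  refine (ContinuousOn.comp_fract'' (Continuous.continuousOn (by fun_prop)) ?_).comp (by fun_prop)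
  have : 0 < Λ * δ := by positivity
  rw [max_eq_left (by linarith), max_eq_right (by nlinarith)]
  ring

theorem periodic_ubar (hΛ : 0 < Λ) (hδ : 0 < δ) (L : ℕ) :
    Function.Periodic (ubar Λ δ) (L * ((Λ + 1) * δ)) := fun x => by
  have hp : (Λ + 1) * δ ≠ 0 := by positivity
  have : (x + L * ((Λ + 1) * δ) + δ) / ((Λ + 1) * δ) = (x + δ) / ((Λ + 1) * δ) + L := by
    rw [add_right_comm, add_div, mul_div_cancel_right₀ _ hp]
  simp only [ubar, this, Int.fract_add_natCast]

/-- The corners of `ubar`. -/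
def corners (Λ δ : ℝ) : Set ℝ :=
  (⋃ k : ℤ, (Ioo (k * ((Λ + 1) * δ) - δ) (k * ((Λ + 1) * δ)) ∪
    Ioo (k * ((Λ + 1) * δ)) (k * ((Λ + 1) * δ) + Λ * δ)))ᶜ

theorem notMem_corners {x : ℝ} : x ∉ corners Λ δ ↔
    ∃ k : ℤ, x ∈ Ioo (k * ((Λ + 1) * δ) - δ) (k * ((Λ + 1) * δ)) ∨
      x ∈ Ioo (k * ((Λ + 1) * δ)) (k * ((Λ + 1) * δ) + Λ * δ) := by
  simp only [corners, notMem_compl_iff, mem_iUnion, mem_union]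

theorem exists_eq_of_mem_corners (hΛ : 0 < Λ) (hδ : 0 < δ) {x : ℝ} (hx : x ∈ corners Λ δ) :
    ∃ k : ℤ, x = k * ((Λ + 1) * δ) - δ ∨ x = k * ((Λ + 1) * δ) := by
  obtain ⟨k, hk⟩ := exists_mem_Ico_period hΛ hδ x
  refine ⟨k, ?_⟩
  by_contra! hne
  refine notMem_corners.2 ⟨k, ?_⟩ hx
  rcases lt_or_gt_of_ne hne.2 with h | h
  · exact Or.inl ⟨lt_of_le_of_ne hk.1 hne.1.symm, h⟩
  · exact Or.inr ⟨h, hk.2⟩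

theorem countable_corners (hΛ : 0 < Λ) (hδ : 0 < δ) : (corners Λ δ).Countable := by
  refine ((countable_range fun k : ℤ => k * ((Λ + 1) * δ) - δ).union
    (countable_range fun k : ℤ => k * ((Λ + 1) * δ))).mono fun x hx => ?_
  obtain ⟨k, hk | hk⟩ := exists_eq_of_mem_corners hΛ hδ hx
  · exact Or.inl ⟨k, hk.symm⟩
  · exact Or.inr ⟨k, hk.symm⟩

theorem min_le_sub_of_mem_corners (hΛ : 0 < Λ) (hδ : 0 < δ) {x z : ℝ} (hx : x ∈ corners Λ δ)
    (hz : z ∈ corners Λ δ) (hxz : x < z) : min δ (Λ * δ) ≤ z - x := by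
  contrapose! hz
  obtain ⟨hz1, hz2⟩ := lt_min_iff.1 hz
  obtain ⟨k, hk | hk⟩ := exists_eq_of_mem_corners hΛ hδ hx
  · exact notMem_corners.2 ⟨k, Or.inl ⟨by linarith, by linarith⟩⟩
  · exact notMem_corners.2 ⟨k, Or.inr ⟨by linarith, by linarith⟩⟩

theorem corners_inter_Ioo_subset (hΛ : 0 < Λ) (hδ : 0 < δ) {x : ℝ} (hx : x ∈ corners Λ δ) :
    corners Λ δ ∩ Ioo (x - min δ (Λ * δ)) (x + min δ (Λ * δ)) ⊆ {x} := by
  rintro z ⟨hz, hz1, hz2⟩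
  by_contra hne
  rcases lt_or_gt_of_ne (show z ≠ x from hne) with h | h
  · linarith [min_le_sub_of_mem_corners hΛ hδ hz hx h]
  · linarith [min_le_sub_of_mem_corners hΛ hδ hx hz h]

theorem piecewiseAffine_ubar (hΛ : 0 < Λ) (hδ : 0 < δ) : PiecewiseAffine (ubar Λ δ) := by
  refine ⟨corners Λ δ, ?_, fun x hx => ⟨min δ (Λ * δ), by positivity,
    corners_inter_Ioo_subset hΛ hδ hx⟩, fun x hx => ?_⟩
  · exact (isOpen_iUnion fun k => isOpen_Ioo.union isOpen_Ioo).isClosed_compl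
  · obtain ⟨k, hk | hk⟩ := notMem_corners.1 hx
    · obtain ⟨ε, hε, hball⟩ := Metric.isOpen_iff.1 isOpen_Ioo x hk
      refine ⟨ε, hε, -Λ, Λ * (k * ((Λ + 1) * δ)), fun y hy => ?_⟩
      rw [ubar_of_mem_Ioo_neg hΛ hδ (hball hy)]
      ring
    · obtain ⟨ε, hε, hball⟩ := Metric.isOpen_iff.1 isOpen_Ioo x hk
      refine ⟨ε, hε, 1, -(k * ((Λ + 1) * δ)), fun y hy => ?_⟩
      rw [ubar_of_mem_Ioo_pos hΛ hδ (hball hy)]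
      ring

theorem admissible_ubar (hΛ : 0 < Λ) (hδ : 0 < δ) (L : ℕ) :
    Admissible (L * ((Λ + 1) * δ)) Λ δ (ubar Λ δ) where
  cont := continuous_ubar hΛ hδ
  per := periodic_ubar hΛ hδ L
  pwAffine := piecewiseAffine_ubar hΛ hδ
  slopes := by
    filter_upwards [(countable_corners hΛ hδ).ae_notMem volume] with x hx
    obtain ⟨k, hk | hk⟩ := notMem_corners.1 hx
    · exact Or.inr (hasDerivAt_ubar_neg hΛ hδ hk)
    · exact Or.inl (hasDerivAt_ubar_pos hΛ hδ hk)
  negRegion := by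
    have hp : 0 < (Λ + 1) * δ := by positivity
    let e : ℕ ≃ ℤ := Equiv.intEquivNat.symm
    refine ⟨fun n => e n * ((Λ + 1) * δ) - δ, fun n x hx => ?_, fun x hx => ?_, fun i j hij => ?_⟩
    · rw [sub_add_cancel] at hx
      exact hasDerivAt_ubar_neg hΛ hδ hx
    · obtain ⟨k, hk⟩ := exists_mem_Ico_period hΛ hδ x
      refine mem_iUnion.2 ⟨e.symm k, ?_⟩
      simp only [Equiv.apply_symm_apply, sub_add_cancel]
      refine ⟨hk.1, ?_⟩
      by_contra! hlt
      have := hx.unique (hasDerivAt_ubar_pos hΛ hδ ⟨hlt, hk.2⟩)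
      linarith
    · simp only [sub_add_cancel]
      rintro x ⟨⟨h1, h2⟩, h3, h4⟩
      exfalso
      have hΛδ : 0 < Λ * δ := by positivity
      wlog hlt : e i < e j generalizing i j
      · exact this j i hij.symm h3 h4 h1 h2
          (lt_of_le_of_ne (not_lt.1 hlt) (e.injective.ne hij.symm))
      have : (e i : ℝ) + 1 ≤ e j := by exact_mod_cast hlt
      nlinarith

end ubar

theorem Fs_half_bounds_of_minimizer {δ T : ℝ} {L : ℕ} {u : ℝ → ℝ} (hδ : 0 < δ) (hδ1 : δ ≤ 1)
    (hL : 0 < L) (hT : T = L * ((1 / δ + 1) * δ)) (hu : Admissible T (1 / δ) δ u)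
    (hmin : ∀ v : ℝ → ℝ, Admissible T (1 / δ) δ v → Fs (1 / 2) T u ≤ Fs (1 / 2) T v) :
    Real.log (1 / δ) - 2 ≤ Fs (1 / 2) T u ∧ Fs (1 / 2) T u ≤ Real.log (1 / δ) + 2 := by
  have hΛ : 0 < 1 / δ := by positivity
  have hΛδ : 1 / δ * δ = 1 := by field_simp
  have hL' : (0 : ℝ) < L := by exact_mod_cast hL
  have hT0 : 0 < T := by rw [hT]; positivity
  have hadm : Admissible T (1 / δ) δ (ubar (1 / δ) δ) := hT ▸ admissible_ubar hΛ hδ L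
  constructor
  · have := hu.log_sub_le_Fs_half hT0 hδ hδ1 hΛ.le (by linarith)
    linarith
  · have := hadm.Fs_half_le_of_mem_Icc hT0 hδ hδ1 hΛ.le fun x => by
      simpa only [hΛδ] using ubar_mem_Icc hΛ hδ x
    linarith [hmin _ hadm]

/-- asymptotics of the minimal energy for `s = 1/2`. -/
theorem statement4
    (δ : ℕ → ℝ) (hδpos : ∀ n, 0 < δ n) (hδ0 : Tendsto δ atTop (𝓝 0))
    (L : ℕ → ℕ) (hL : ∀ n, 0 < L n)
    (T : ℕ → ℝ) (hT : ∀ n, T n = (L n : ℝ) * ((1 / δ n + 1) * δ n))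
    (u : ℕ → ℝ → ℝ) (hadm : ∀ n, Admissible (T n) (1 / δ n) (δ n) (u n))
    (hmin : ∀ n, ∀ v : ℝ → ℝ, Admissible (T n) (1 / δ n) (δ n) v →
      Fs (1 / 2) (T n) (u n) ≤ Fs (1 / 2) (T n) v) :
    Tendsto (fun n => Fs (1 / 2) (T n) (u n) / Real.log (1 / δ n)) atTop (𝓝 1) := by
  have hinv : Tendsto (fun n => 1 / δ n) atTop atTop := by
    simp_rw [one_div]
    exact tendsto_inv_nhdsGT_zero.comp
      (tendsto_nhdsWithin_iff.2 ⟨hδ0, Eventually.of_forall hδpos⟩)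
  have hlog : Tendsto (fun n => Real.log (1 / δ n)) atTop atTop :=
    Real.tendsto_log_atTop.comp hinv
  have hsmall : Tendsto (fun n => 2 / Real.log (1 / δ n)) atTop (𝓝 0) :=
    hlog.const_div_atTop 2
  have hlower : Tendsto (fun n => 1 - 2 / Real.log (1 / δ n)) atTop (𝓝 1) := by
    simpa using hsmall.const_sub 1
  have hupper : Tendsto (fun n => 1 + 2 / Real.log (1 / δ n)) atTop (𝓝 1) := by
    simpa using hsmall.const_add 1
  have hbounds : ∀ᶠ n in atTop, 0 < Real.log (1 / δ n) ∧
      Real.log (1 / δ n) - 2 ≤ Fs (1 / 2) (T n) (u n) ∧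
      Fs (1 / 2) (T n) (u n) ≤ Real.log (1 / δ n) + 2 := by
    filter_upwards [hlog.eventually_gt_atTop 0, hδ0.eventually_le_const one_pos] with n hn hn1
    exact ⟨hn, Fs_half_bounds_of_minimizer (hδpos n) hn1 (hL n) (hT n) (hadm n) (hmin n)⟩
  refine tendsto_of_tendsto_of_tendsto_of_le_of_le' hlower hupper ?_ ?_
  · filter_upwards [hbounds] with n ⟨hn, h1, _⟩
    rw [le_div_iff₀ hn, sub_mul, div_mul_cancel₀ _ hn.ne', one_mul]
    exact h1
  · filter_upwards [hbounds] with n ⟨hn, _, h2⟩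
    rw [div_le_iff₀ hn, add_mul, div_mul_cancel₀ _ hn.ne', one_mul]
    exact h2
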